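/- arXiv:2503.10138 — 3 statements merged into one kernel-verified Lean document; each statement's English description precedes it below -/
import Mathlib

section
/- Let f : ℝⁿ → ℝ be a convex L-smooth function (L > 0), let η > 0, let x_0 ∈ ℝⁿ, and set x_1 = x_0 - η • ∇f(x_0) and x_2 = x_1 - η • ∇f(x_1). Then f(x_2) - f(x_1) - (f(x_1) - f(x_0)) ≥ (7/(8L) - η/2) · ‖∇f(x_1) - ∇f(x_0)‖² + (1/(2L)) · ‖∇f(x_2) - (1/2) • ∇f(x_1) - (1/2) • ∇f(x_0)‖². -/
section

variable {E : Type*} [NormedAddCommGroup E] [InnerProductSpace ℝ E] [CompleteSpace E]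
  {f : E → ℝ}

open scoped InnerProductSpace

theorem hasDerivAt_comp_add_smul_of_differentiable (hf : Differentiable ℝ f) (x v : E) (t : ℝ) :
    HasDerivAt (fun s : ℝ => f (x + s • v)) ⟪gradient f (x + t • v), v⟫_ℝ t := by
  have hline : HasDerivAt (fun s : ℝ => x + s • v) v t := by
    simpa using ((hasDerivAt_id t).smul_const v).const_add x
  exact (hf (x + t • v)).hasGradientAt.hasFDerivAt.comp_hasDerivAt t hline

/-- A differentiable convex function lies above its tangent hyperplanes. -/
theorem ConvexOn.add_inner_gradient_le (hconv : ConvexOn ℝ Set.univ f)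
    (hf : Differentiable ℝ f) (x y : E) :
    f x + ⟪gradient f x, y - x⟫_ℝ ≤ f y := by
  have hline : ConvexOn ℝ Set.univ (fun s : ℝ => f (x + s • (y - x))) := by
    have h := hconv.comp_affineMap (AffineMap.lineMap x y : ℝ →ᵃ[ℝ] E)
    simpa [Function.comp_def, AffineMap.lineMap_apply, add_comm] using h
  have h := hline.le_slope_of_hasDerivAt (Set.mem_univ 0) (Set.mem_univ 1) one_pos
    (hasDerivAt_comp_add_smul_of_differentiable hf x (y - x) 0)
  simp only [slope_def_field, zero_smul, one_smul, add_zero, add_sub_cancel, sub_zero,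
    div_one] at h
  linarith

/-- The descent lemma: an `L`-smooth function lies below its quadratic upper models. -/
theorem le_add_inner_gradient_add_sq_norm {L : ℝ} (hL : 0 ≤ L) (hf : Differentiable ℝ f)
    (hlip : LipschitzWith L.toNNReal (gradient f)) (x y : E) :
    f y ≤ f x + ⟪gradient f x, y - x⟫_ℝ + L / 2 * ‖y - x‖ ^ 2 := by
  set v := y - x with hv
  have hderiv (t : ℝ) : HasDerivAt
      (fun s : ℝ => f (x + s • v) - s * ⟪gradient f x, v⟫_ℝ - s ^ 2 * (L / 2 * ‖v‖ ^ 2))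
      (⟪gradient f (x + t • v), v⟫_ℝ - ⟪gradient f x, v⟫_ℝ - 2 * t * (L / 2 * ‖v‖ ^ 2)) t := by
    refine HasDerivAt.congr_deriv (((hasDerivAt_comp_add_smul_of_differentiable hf x v t).sub
      ((hasDerivAt_id t).mul_const ⟪gradient f x, v⟫_ℝ)).sub
      ((hasDerivAt_pow 2 t).mul_const (L / 2 * ‖v‖ ^ 2))) (by simp)
  have hanti := antitoneOn_of_deriv_nonpos (convex_Icc (0 : ℝ) 1)
    (fun t _ => (hderiv t).continuousAt.continuousWithinAt)
    (fun t _ => (hderiv t).differentiableAt.differentiableWithinAt) (by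
      intro t ht
      rw [interior_Icc] at ht
      rw [(hderiv t).deriv, ← inner_sub_left]
      have hgrad : ‖gradient f (x + t • v) - gradient f x‖ ≤ L * (t * ‖v‖) := by
        have h := hlip.dist_le_mul (x + t • v) x
        rwa [dist_eq_norm, dist_eq_norm, add_sub_cancel_left, norm_smul, Real.norm_eq_abs,
          abs_of_pos ht.1, Real.coe_toNNReal L hL] at h
      have hinner := (real_inner_le_norm (gradient f (x + t • v) - gradient f x) v).trans
        (mul_le_mul_of_nonneg_right hgrad (norm_nonneg v))
      linarith)
  have h := hanti (Set.left_mem_Icc.2 zero_le_one) (Set.right_mem_Icc.2 zero_le_one) zero_le_one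
  have hy : x + v = y := by simp [hv]
  simp only [one_smul, zero_smul, add_zero, hy] at h
  linarith

/-- The interpolation inequality for convex `L`-smooth functions. -/
theorem ConvexOn.add_inner_gradient_add_sq_norm_le {L : ℝ} (hL : 0 < L)
    (hconv : ConvexOn ℝ Set.univ f) (hf : Differentiable ℝ f)
    (hlip : LipschitzWith L.toNNReal (gradient f)) (x y : E) :
    f x + ⟪gradient f x, y - x⟫_ℝ + 1 / (2 * L) * ‖gradient f y - gradient f x‖ ^ 2 ≤ f y := by
  set d := gradient f y - gradient f x with hd
  have hlower := hconv.add_inner_gradient_le hf x (y - L⁻¹ • d)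
  have hupper := le_add_inner_gradient_add_sq_norm hL.le hf hlip y (y - L⁻¹ • d)
  rw [sub_sub_cancel_left, norm_neg, norm_smul, inner_neg_right, inner_smul_right, mul_pow,
    Real.norm_eq_abs, sq_abs] at hupper
  rw [sub_right_comm, inner_sub_right, inner_smul_right] at hlower
  have hinner : ⟪gradient f y, d⟫_ℝ - ⟪gradient f x, d⟫_ℝ = ‖d‖ ^ 2 := by
    rw [← inner_sub_left, ← hd, real_inner_self_eq_norm_sq]
  have hcoef : L / 2 * (L⁻¹ ^ 2 * ‖d‖ ^ 2) = L⁻¹ * ‖d‖ ^ 2 - 1 / (2 * L) * ‖d‖ ^ 2 := by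
    field_simp
    ring
  rw [hcoef, ← hinner] at hupper
  rw [← hinner]
  linarith

end


/-- Key inequality behind the convexity of the gradient descent optimization curve:
for convex `L`-smooth `f` and two gradient steps `x₁ = x₀ - η • ∇f x₀`,
`x₂ = x₁ - η • ∇f x₁`, we have
`f x₂ - f x₁ - (f x₁ - f x₀) ≥ (7/(8L) - η/2) ‖∇f x₁ - ∇f x₀‖² + (1/(2L)) ‖∇f x₂ - ½ ∇f x₁ - ½ ∇f x₀‖²`. -/
theorem gradientDescent_two_step_inequality
    {n : ℕ} (f : EuclideanSpace ℝ (Fin n) → ℝ) (L : ℝ) (hL : 0 < L)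
    (hconv : ConvexOn ℝ Set.univ f) (hdiff : Differentiable ℝ f)
    (hlip : LipschitzWith L.toNNReal (gradient f))
    (η : ℝ) (hη : 0 < η) (x₀ : EuclideanSpace ℝ (Fin n))
    (x₁ x₂ : EuclideanSpace ℝ (Fin n))
    (hx₁ : x₁ = x₀ - η • gradient f x₀) (hx₂ : x₂ = x₁ - η • gradient f x₁) :
    f x₂ - f x₁ - (f x₁ - f x₀) ≥
      (7 / (8 * L) - η / 2) * ‖gradient f x₁ - gradient f x₀‖ ^ 2 +
        (1 / (2 * L)) *
          ‖gradient f x₂ - (1 / 2 : ℝ) • gradient f x₁ - (1 / 2 : ℝ) • gradient f x₀‖ ^ 2 := by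
  have h₀₁ := hconv.add_inner_gradient_add_sq_norm_le hL hdiff hlip x₁ x₀
  have h₁₂ := hconv.add_inner_gradient_add_sq_norm_le hL hdiff hlip x₁ x₂
  have h₀₂ := hconv.add_inner_gradient_add_sq_norm_le hL hdiff hlip x₀ x₂
  have e₀₁ : x₀ - x₁ = η • gradient f x₀ := by rw [hx₁]; abel
  have e₁₂ : x₂ - x₁ = -(η • gradient f x₁) := by rw [hx₂]; abel
  have e₀₂ : x₂ - x₀ = -(η • gradient f x₁) - η • gradient f x₀ := by
    rw [← e₁₂, ← e₀₁]; abel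
  rw [e₀₁] at h₀₁
  rw [e₁₂] at h₁₂
  rw [e₀₂] at h₀₂
  generalize gradient f x₀ = a at *
  generalize gradient f x₁ = b at *
  generalize gradient f x₂ = c at *
  have hL' : 7 / (8 * L) = 7 / 4 * (1 / (2 * L)) := by ring
  rw [hL']
  generalize 1 / (2 * L) = k at *
  simp only [← real_inner_self_eq_norm_sq, inner_sub_left, inner_sub_right, inner_neg_right,
    inner_smul_left, inner_smul_right, real_inner_comm a b, real_inner_comm a c,
    real_inner_comm b c, conj_trivial] at h₀₁ h₁₂ h₀₂ ⊢
  linarith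
end

section
/- Let f : ℝⁿ → ℝ be a convex L-smooth function (L > 0), let x_0 ∈ ℝⁿ, and let x : ℝ → ℝⁿ be a solution of the gradient flow equation: x(0) = x_0 and for every t ≥ 0, x'(t) = -∇f(x(t)). Then the map t ↦ ‖∇f(x(t))‖ is non-increasing on [0,∞). -/
/-- The gradient of a differentiable convex function is a monotone operator. -/
theorem ConvexOn.inner_gradient_sub_nonneg
    {E : Type*} [NormedAddCommGroup E] [InnerProductSpace ℝ E] [CompleteSpace E] {f : E → ℝ}
    (hconv : ConvexOn ℝ Set.univ f) (hdiff : Differentiable ℝ f) (a b : E) :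
    0 ≤ inner ℝ (b - a) (gradient f b - gradient f a) := by
  have hφ : ConvexOn ℝ Set.univ (f ∘ AffineMap.lineMap (k := ℝ) a b) :=
    hconv.comp_affineMap (AffineMap.lineMap (k := ℝ) a b)
  have hderiv (s : ℝ) : HasDerivAt (f ∘ AffineMap.lineMap (k := ℝ) a b)
      (inner ℝ (gradient f (AffineMap.lineMap a b s)) (b - a)) s := by
    have h := (hdiff (AffineMap.lineMap a b s)).hasGradientAt.hasFDerivAt.comp_hasDerivAt s
      (AffineMap.hasDerivAt_lineMap (a := a) (b := b) (x := s))
    simpa using h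
  have h₀ := hφ.le_slope_of_hasDerivAt (Set.mem_univ 0) (Set.mem_univ 1) one_pos (hderiv 0)
  have h₁ := hφ.slope_le_of_hasDerivAt (Set.mem_univ 0) (Set.mem_univ 1) one_pos (hderiv 1)
  have h := h₀.trans h₁
  simp only [AffineMap.lineMap_apply_zero, AffineMap.lineMap_apply_one] at h
  rw [real_inner_comm, inner_sub_left]
  linarith

/-- The distance between two gradient flow trajectories of a convex function is non-increasing. -/
theorem antitoneOn_norm_sub_of_gradientFlow
    {E : Type*} [NormedAddCommGroup E] [InnerProductSpace ℝ E] [CompleteSpace E] {f : E → ℝ}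
    (hconv : ConvexOn ℝ Set.univ f) (hdiff : Differentiable ℝ f) {x y : ℝ → E}
    (hx : ∀ t ∈ Set.Ici (0 : ℝ), HasDerivAt x (-(gradient f (x t))) t)
    (hy : ∀ t ∈ Set.Ici (0 : ℝ), HasDerivAt y (-(gradient f (y t))) t) :
    AntitoneOn (fun t => ‖y t - x t‖) (Set.Ici (0 : ℝ)) := by
  have hderiv : ∀ t ∈ Set.Ici (0 : ℝ), HasDerivAt (fun t => ‖y t - x t‖ ^ 2)
      (2 * inner ℝ (y t - x t) (-gradient f (y t) - -gradient f (x t))) t :=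
    fun t ht => ((hy t ht).sub (hx t ht)).norm_sq
  have hsq : AntitoneOn (fun t => ‖y t - x t‖ ^ 2) (Set.Ici (0 : ℝ)) := by
    refine antitoneOn_of_deriv_nonpos (convex_Ici 0)
      (fun t ht => (hderiv t ht).continuousAt.continuousWithinAt)
      (fun t ht => (hderiv t (interior_subset ht)).differentiableAt.differentiableWithinAt)
      fun t ht => ?_
    rw [(hderiv t (interior_subset ht)).deriv, ← neg_sub', inner_neg_right]
    linarith [hconv.inner_gradient_sub_nonneg hdiff (x t) (y t)]
  exact fun s hs t ht hst =>
    (sq_le_sq₀ (norm_nonneg _) (norm_nonneg _)).mp (hsq hs ht hst)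

/-- For a convex `L`-smooth function `f`, the gradient norm along gradient flow,
`t ↦ ‖∇f (x t)‖`, is non-increasing on `[0, ∞)`. -/
theorem gradientFlow_gradNorm_antitone
    {n : ℕ} (f : EuclideanSpace ℝ (Fin n) → ℝ) (L : ℝ) (hL : 0 < L)
    (hconv : ConvexOn ℝ Set.univ f) (hdiff : Differentiable ℝ f)
    (hlip : LipschitzWith L.toNNReal (gradient f))
    (x₀ : EuclideanSpace ℝ (Fin n)) (x : ℝ → EuclideanSpace ℝ (Fin n))
    (hx0 : x 0 = x₀)
    (hflow : ∀ t ∈ Set.Ici (0 : ℝ), HasDerivAt x (-(gradient f (x t))) t) :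
    AntitoneOn (fun t => ‖gradient f (x t)‖) (Set.Ici (0 : ℝ)) := by
  intro s hs t ht hst
  have hs' := (hflow s hs).tendsto_slope_zero_right.norm
  have ht' := (hflow t ht).tendsto_slope_zero_right.norm
  rw [norm_neg] at hs' ht'
  refine le_of_tendsto_of_tendsto ht' hs' ?_
  filter_upwards [self_mem_nhdsWithin] with h hh
  have hshift : ∀ r ∈ Set.Ici (0 : ℝ),
      HasDerivAt (fun r => x (r + h)) (-(gradient f (x (r + h)))) r := fun r hr =>
    (hflow (r + h) (Set.mem_Ici.mpr (add_nonneg hr (le_of_lt hh)))).comp_add_const r h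
  rw [norm_smul, norm_smul]
  gcongr
  exact antitoneOn_norm_sub_of_gradientFlow hconv hdiff hflow hshift hs ht hst
end

section
/- Let f : ℝⁿ → ℝ be a convex L-smooth function (L > 0), x_0 ∈ ℝⁿ, and η ∈ (0, 1/L]. Let (X_k) be the gradient descent iterates X_0 = x_0, X_{k+1} = X_k - η • ∇f(X_k), and define the Euler approximation x^(η) : [0,∞) → ℝⁿ by x^(η)(t) = X_{⌊t/η⌋} - (t - ⌊t/η⌋·η) • ∇f(X_{⌊t/η⌋}). Then the map t ↦ f(x^(η)(t)) is convex on [0,∞). -/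
/-- A function on a convex set that has a supporting line at every point is convex. -/
theorem convexOn_of_forall_exists_supporting_line {S : Set ℝ} (hS : Convex ℝ S) {φ : ℝ → ℝ}
    (h : ∀ s ∈ S, ∃ m : ℝ, ∀ t ∈ S, φ s + m * (t - s) ≤ φ t) : ConvexOn ℝ S φ := by
  refine ⟨hS, fun x hx y hy a b ha hb hab => ?_⟩
  obtain ⟨m, hm⟩ := h _ (hS hx hy ha hb hab)
  have h₁ := mul_le_mul_of_nonneg_left (hm x hx) ha
  have h₂ := mul_le_mul_of_nonneg_left (hm y hy) hb
  simp only [smul_eq_mul] at *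
  obtain rfl : b = 1 - a := by linarith
  linarith

section Gradient

variable {E : Type*} [NormedAddCommGroup E] [InnerProductSpace ℝ E] [CompleteSpace E]
  {f : E → ℝ} {L : ℝ}

/-- Derivative of a differentiable function along a line, in terms of the gradient. -/
theorem hasDerivAt_comp_add_smul (hdiff : Differentiable ℝ f) (x v : E) (t : ℝ) :
    HasDerivAt (fun s : ℝ => f (x + s • v)) (inner ℝ (gradient f (x + t • v)) v) t := by
  have hf := (hdiff (x + t • v)).hasGradientAt.hasFDerivAt
  have hline : HasDerivAt (fun s : ℝ => x + s • v) v t := by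
    simpa using ((hasDerivAt_id t).smul_const v).const_add x
  exact hf.comp_hasDerivAt t hline

/-- First-order characterization of convexity: the graph lies above its tangent hyperplanes. -/
theorem add_inner_gradient_le_of_convexOn (hconv : ConvexOn ℝ Set.univ f)
    (hdiff : Differentiable ℝ f) (x y : E) :
    f x + inner ℝ (gradient f x) (y - x) ≤ f y := by
  have hline : ConvexOn ℝ Set.univ (fun s : ℝ => f (x + s • (y - x))) := by
    have := hconv.comp_affineMap (AffineMap.lineMap x y : ℝ →ᵃ[ℝ] E)
    simpa [Function.comp_def, AffineMap.lineMap_apply, add_comm] using this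
  have hslope := hline.le_slope_of_hasDerivAt (Set.mem_univ 0) (Set.mem_univ 1) one_pos
    (hasDerivAt_comp_add_smul hdiff x (y - x) 0)
  simp only [slope_def_field, zero_smul, one_smul, add_zero, sub_zero, div_one,
    add_sub_cancel] at hslope
  linarith

/-- The descent lemma: an `L`-smooth function lies below its quadratic upper models. -/
theorem le_add_inner_gradient_add_sq (hL : 0 ≤ L) (hdiff : Differentiable ℝ f)
    (hlip : LipschitzWith L.toNNReal (gradient f)) (x v : E) :
    f (x + v) ≤ f x + inner ℝ (gradient f x) v + L / 2 * ‖v‖ ^ 2 := by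
  have hmodel (t : ℝ) : HasDerivAt
      (fun s : ℝ => f x + s * inner ℝ (gradient f x) v + L / 2 * ‖v‖ ^ 2 * s ^ 2)
      (inner ℝ (gradient f x) v + L * ‖v‖ ^ 2 * t) t := by
    have := (((hasDerivAt_id t).mul_const (inner ℝ (gradient f x) v)).const_add (f x)).add
      (((hasDerivAt_id t).pow 2).const_mul (L / 2 * ‖v‖ ^ 2))
    refine HasDerivAt.congr_deriv this ?_
    simp only [id_eq, Nat.cast_ofNat]
    ring
  have hf := hasDerivAt_comp_add_smul hdiff x v
  have key := image_le_of_deriv_right_le_deriv_boundary (a := 0) (b := 1)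
    (fun t _ => (hf t).continuousAt.continuousWithinAt) (fun t _ => (hf t).hasDerivWithinAt)
    (by simp) (fun t _ => (hmodel t).continuousAt.continuousWithinAt)
    (fun t _ => (hmodel t).hasDerivWithinAt) (fun t ht => ?_)
    (Set.right_mem_Icc.2 zero_le_one)
  · simpa using key
  have hinner := real_inner_le_norm (gradient f (x + t • v) - gradient f x) v
  have hdist := hlip.dist_le_mul (x + t • v) x
  rw [dist_eq_norm, dist_eq_norm, add_sub_cancel_left, norm_smul, Real.norm_of_nonneg ht.1,
    Real.coe_toNNReal _ hL] at hdist
  rw [inner_sub_left] at hinner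
  nlinarith [mul_le_mul_of_nonneg_right hdist (norm_nonneg v)]

/-- First-order lower bound for a convex `L`-smooth function, improved by the squared distance of
the gradients. -/
theorem add_inner_gradient_add_sq_le (hL : 0 < L) (hconv : ConvexOn ℝ Set.univ f)
    (hdiff : Differentiable ℝ f) (hlip : LipschitzWith L.toNNReal (gradient f)) (x y : E) :
    f x + inner ℝ (gradient f x) (y - x) + 1 / (2 * L) * ‖gradient f y - gradient f x‖ ^ 2
      ≤ f y := by
  set w := gradient f y - gradient f x with hw
  have hup := le_add_inner_gradient_add_sq hL.le hdiff hlip y (-(1 / L) • w)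
  have hlow := add_inner_gradient_le_of_convexOn hconv hdiff x (y + -(1 / L) • w)
  have hsq : inner ℝ (gradient f y) w - inner ℝ (gradient f x) w = ‖w‖ ^ 2 := by
    rw [← inner_sub_left, ← hw, real_inner_self_eq_norm_sq]
  rw [add_sub_right_comm, inner_add_right, real_inner_smul_right] at hlow
  rw [real_inner_smul_right, norm_smul, mul_pow, Real.norm_eq_abs, sq_abs] at hup
  have hcoef : L / 2 * ((-(1 / L)) ^ 2 * ‖w‖ ^ 2) = 1 / (2 * L) * ‖w‖ ^ 2 := by
    field_simp
  have hsplit : 1 / L * ‖w‖ ^ 2 = 2 * (1 / (2 * L) * ‖w‖ ^ 2) := by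
    field_simp
  rw [hcoef] at hup
  rw [← hsq, mul_sub] at hsplit
  rw [← hsq] at hup ⊢
  linarith

/-- The gradient of a convex `L`-smooth function is `1 / L`-cocoercive (Baillon–Haddad). -/
theorem sq_norm_gradient_sub_le_mul_inner (hL : 0 < L) (hconv : ConvexOn ℝ Set.univ f)
    (hdiff : Differentiable ℝ f) (hlip : LipschitzWith L.toNNReal (gradient f)) (x y : E) :
    ‖gradient f x - gradient f y‖ ^ 2 ≤ L * inner ℝ (gradient f x - gradient f y) (x - y) := by
  have h₁ := add_inner_gradient_add_sq_le hL hconv hdiff hlip x y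
  have h₂ := add_inner_gradient_add_sq_le hL hconv hdiff hlip y x
  rw [← neg_sub x y, inner_neg_right, norm_sub_rev] at h₁
  have hsum : 1 / L * ‖gradient f x - gradient f y‖ ^ 2
      ≤ inner ℝ (gradient f x - gradient f y) (x - y) := by
    have hsplit : 1 / L * ‖gradient f x - gradient f y‖ ^ 2
        = 2 * (1 / (2 * L) * ‖gradient f x - gradient f y‖ ^ 2) := by
      field_simp
    rw [inner_sub_left, hsplit]
    linarith
  rwa [one_div, inv_mul_le_iff₀ hL] at hsum

/-- Tangent bound for a convex function along the ray `r ↦ x - r • g`. -/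
theorem add_inner_gradient_mul_le (hconv : ConvexOn ℝ Set.univ f) (hdiff : Differentiable ℝ f)
    (x g : E) (r v : ℝ) :
    f (x - r • g) + inner ℝ (gradient f (x - r • g)) g * (r - v) ≤ f (x - v • g) := by
  have h := add_inner_gradient_le_of_convexOn hconv hdiff (x - r • g) (x - v • g)
  rwa [sub_sub_sub_cancel_left, ← sub_smul, real_inner_smul_right, mul_comm] at h

/-- The directional derivative of a convex function is monotone along a ray. -/
theorem inner_gradient_antitone (hconv : ConvexOn ℝ Set.univ f) (hdiff : Differentiable ℝ f)
    (x g : E) : Antitone fun r : ℝ => inner ℝ (gradient f (x - r • g)) g := by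
  intro r v hrv
  rcases hrv.eq_or_lt with rfl | hlt
  · exact le_rfl
  have h₁ := add_inner_gradient_mul_le hconv hdiff x g r v
  have h₂ := add_inner_gradient_mul_le hconv hdiff x g v r
  refine le_of_mul_le_mul_right ?_ (sub_pos.2 hlt)
  linarith

/-- A gradient step of size at most `1 / L` satisfies `‖∇f x⁺‖² ≤ ⟪∇f x⁺, ∇f x⟫`. -/
theorem sq_norm_gradient_step_le_inner (hL : 0 < L) (hconv : ConvexOn ℝ Set.univ f)
    (hdiff : Differentiable ℝ f) (hlip : LipschitzWith L.toNNReal (gradient f)) {η : ℝ}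
    (hη : 0 < η) (hηL : η ≤ 1 / L) (x : E) :
    ‖gradient f (x - η • gradient f x)‖ ^ 2
      ≤ inner ℝ (gradient f (x - η • gradient f x)) (gradient f x) := by
  have h := sq_norm_gradient_sub_le_mul_inner hL hconv hdiff hlip x (x - η • gradient f x)
  set g := gradient f x
  set g' := gradient f (x - η • g)
  rw [sub_sub_cancel, real_inner_smul_right, ← mul_assoc] at h
  have hLη : L * η ≤ 1 := by rwa [le_div_iff₀ hL, mul_comm] at hηL
  have hnonneg : 0 ≤ inner ℝ (g - g') g := by
    by_contra! hneg
    nlinarith [sq_nonneg ‖g - g'‖, mul_pos hL hη]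
  have h' : ‖g - g'‖ ^ 2 ≤ inner ℝ (g - g') g := by nlinarith
  rw [norm_sub_sq_real, inner_sub_left, real_inner_self_eq_norm_sq, real_inner_comm] at h'
  linarith

end Gradient

/-- Summing one-step upper bounds on the decrease of a sequence. -/
theorem le_add_mul_of_forall_step {F : ℕ → ℝ} {c : ℝ} {i k : ℕ} (hik : i ≤ k)
    (h : ∀ l, i ≤ l → F l ≤ F (l + 1) + c) : F i ≤ F k + c * ((k : ℝ) - i) := by
  induction k, hik using Nat.le_induction with
  | base => simp
  | succ k hk ih =>
    have := h k hk
    push_cast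
    linarith

/-- Summing one-step lower bounds on the decrease of a sequence. -/
theorem add_mul_le_of_forall_step {F : ℕ → ℝ} {c : ℝ} {i k : ℕ} (hik : i ≤ k)
    (h : ∀ l, l < k → F (l + 1) + c ≤ F l) : F k + c * ((k : ℝ) - i) ≤ F i := by
  induction k, hik using Nat.le_induction with
  | base => simp
  | succ k hk ih =>
    have := h k k.lt_succ_self
    have := ih fun l hl => h l (hl.trans k.lt_succ_self)
    push_cast
    linarith


/-- For a convex `L`-smooth `f` and step size `η ∈ (0, 1/L]`, the map
`t ↦ f (x^(η) t)` along Euler's approximation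
`x^(η) t = X ⌊t/η⌋₊ - (t - ⌊t/η⌋₊ η) • ∇f (X ⌊t/η⌋₊)` is convex on `[0, ∞)`. -/
theorem euler_approx_curve_convex
    {n : ℕ} (f : EuclideanSpace ℝ (Fin n) → ℝ) (L : ℝ) (hL : 0 < L)
    (hconv : ConvexOn ℝ Set.univ f) (hdiff : Differentiable ℝ f)
    (hlip : LipschitzWith L.toNNReal (gradient f))
    (x₀ : EuclideanSpace ℝ (Fin n))
    (η : ℝ) (hη : η ∈ Set.Ioc (0 : ℝ) (1 / L))
    (X : ℕ → EuclideanSpace ℝ (Fin n)) (hX0 : X 0 = x₀)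
    (hXs : ∀ k : ℕ, X (k + 1) = X k - η • gradient f (X k)) :
    ConvexOn ℝ (Set.Ici (0 : ℝ))
      (fun t => f (X ⌊t / η⌋₊ - (t - (⌊t / η⌋₊ : ℝ) * η) • gradient f (X ⌊t / η⌋₊))) := by
  obtain ⟨hη0, hηL⟩ := hη
  set g : ℕ → EuclideanSpace ℝ (Fin n) := fun k => gradient f (X k) with hg
  have hray (k : ℕ) (r v : ℝ) := add_inner_gradient_mul_le hconv hdiff (X k) (g k) r v
  have hstart (k : ℕ) (v : ℝ) : f (X k) ≤ f (X k - v • g k) + ‖g k‖ ^ 2 * v := by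
    have h := hray k 0 v
    rw [zero_smul, sub_zero, real_inner_self_eq_norm_sq] at h
    linarith
  have hinner (k : ℕ) : ‖g (k + 1)‖ ^ 2 ≤ inner ℝ (g (k + 1)) (g k) := by
    simpa only [hg, hXs] using
      sq_norm_gradient_step_le_inner hL hconv hdiff hlip hη0 hηL (X k)
  have hend (k : ℕ) {v : ℝ} (hv : v ≤ η) :
      f (X (k + 1)) + ‖g (k + 1)‖ ^ 2 * (η - v) ≤ f (X k - v • g k) := by
    have h := hray k η v
    rw [← hXs k] at h
    have := mul_le_mul_of_nonneg_right (hinner k) (sub_nonneg.2 hv)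
    linarith
  have hslope (k : ℕ) {r : ℝ} (h0 : 0 ≤ r) (h1 : r ≤ η) :
      ‖g (k + 1)‖ ^ 2 ≤ inner ℝ (gradient f (X k - r • g k)) (g k) ∧
        inner ℝ (gradient f (X k - r • g k)) (g k) ≤ ‖g k‖ ^ 2 := by
    have hanti := inner_gradient_antitone hconv hdiff (X k) (g k)
    constructor
    · have h := hanti h1
      simp only [hg, ← hXs k] at h
      exact (hinner k).trans h
    · simpa [hg, real_inner_self_eq_norm_sq] using hanti h0
  have hD : Antitone fun k => ‖g k‖ ^ 2 := antitone_nat_of_succ_le fun k =>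
    (hslope k le_rfl hη0.le).1.trans (hslope k le_rfl hη0.le).2
  have hfloor {t : ℝ} (ht : 0 ≤ t) :
      0 ≤ t - (⌊t / η⌋₊ : ℝ) * η ∧ t - (⌊t / η⌋₊ : ℝ) * η ≤ η := by
    have h₁ := Nat.floor_le (div_nonneg ht hη0.le)
    have h₂ := Nat.lt_floor_add_one (t / η)
    rw [le_div_iff₀ hη0] at h₁
    rw [div_lt_iff₀ hη0] at h₂
    constructor <;> linarith
  refine convexOn_of_forall_exists_supporting_line (convex_Ici 0) fun s hs => ?_
  obtain ⟨hr0, hr1⟩ := hfloor hs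
  set j := ⌊s / η⌋₊
  set r := s - (j : ℝ) * η with hr
  obtain ⟨hc1, hc2⟩ := hslope j hr0 hr1
  have hrayj := hray j r
  set c := inner ℝ (gradient f (X j - r • g j)) (g j)
  refine ⟨-c, fun t ht => ?_⟩
  obtain ⟨hv0, hv1⟩ := hfloor ht
  set k := ⌊t / η⌋₊
  set v := t - (k : ℝ) * η with hv
  change f (X j - r • g j) + -c * (t - s) ≤ f (X k - v • g k)
  clear_value c j k r v
  obtain rfl : s = j * η + r := by rw [hr]; ring
  obtain rfl : t = k * η + v := by rw [hv]; ring
  rcases lt_trichotomy j k with hjk | rfl | hkj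
  · have h₁ := hrayj η
    rw [← hXs j] at h₁
    have h₂ := le_add_mul_of_forall_step (F := fun i => f (X i)) (c := c * η)
      (Nat.succ_le_of_lt hjk) fun l hl => by
        have h := hstart l η
        rw [← hXs l] at h
        have := mul_le_mul_of_nonneg_right ((hD hl).trans hc1) hη0.le
        linarith
    have h₃ := hstart k v
    have h₄ := mul_le_mul_of_nonneg_right ((hD (Nat.succ_le_of_lt hjk)).trans hc1) hv0
    push_cast at h₂
    linarith
  · linarith [hrayj v]
  · have h₁ := hrayj 0
    simp only [zero_smul, sub_zero] at h₁
    have h₂ := add_mul_le_of_forall_step (F := fun i => f (X i)) (c := c * η)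
      (Nat.succ_le_of_lt hkj) fun l hl => by
        have h := hend l hη0.le
        simp only [zero_smul, sub_zero] at h
        have := mul_le_mul_of_nonneg_right (hc2.trans (hD (Nat.succ_le_of_lt hl))) hη0.le
        linarith
    have h₃ := hend k hv1
    have h₄ := mul_le_mul_of_nonneg_right (hc2.trans (hD (Nat.succ_le_of_lt hkj)))
      (sub_nonneg.2 hv1)
    push_cast at h₂
    linarith
end
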